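/- arXiv:math/0702192 — 2 statements merged into one kernel-verified Lean document; each statement's English description precedes it below -/
import Mathlib

section
/- Suppose W is finite and θ has the NOF property, and let w₀ be the longest element of W. If ℓ^θ(w₀) = 1, then w₀ has a reduced S̲-expression s̲₁⋯s̲ₖ whose first letter satisfies θ(s₁) = s₁. -/
namespace TwistedIdentitiesPaper

open scoped Classical

variable {B : Type*} {W : Type*} [Group W] {M : CoxeterMatrix B}

/-- The Bruhat order on `W`, defined via the subword property: `u ≤ v` iff every
reduced expression for `v` contains a subword representing `u`. -/
def bruhatLE (cs : CoxeterSystem M W) (u v : W) : Prop :=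
  ∀ l : List B, cs.IsReduced l → cs.wordProd l = v →
    ∃ l' : List B, l'.Sublist l ∧ cs.wordProd l' = u

/-- The strict Bruhat order. -/
def bruhatLT (cs : CoxeterSystem M W) (u v : W) : Prop :=
  bruhatLE cs u v ∧ u ≠ v

/-- The action `w ↦ w ⋅ s̲ᵢ`: `w ⋅ s̲ᵢ = w sᵢ` if `θ(sᵢ) w sᵢ = w`, and
`w ⋅ s̲ᵢ = θ(sᵢ) w sᵢ` otherwise. -/
noncomputable def twistAct (cs : CoxeterSystem M W) (θ : W ≃* W) (w : W) (i : B) : W :=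
  if θ (cs.simple i) * w * cs.simple i = w then w * cs.simple i
  else θ (cs.simple i) * w * cs.simple i

/-- `e ⋅ s̲₁ ⋯ s̲ₖ` for a word `s₁ ⋯ sₖ`. -/
noncomputable def twistProd (cs : CoxeterSystem M W) (θ : W ≃* W) (l : List B) : W :=
  l.foldl (twistAct cs θ) 1

/-- The set of twisted involutions `I(θ) = {w : θ(w) = w⁻¹}`. -/
def twistedInvolutions (θ : W ≃* W) : Set W := {w | θ w = w⁻¹}

/-- The set of twisted identities `ι(θ) = {θ(w⁻¹) w : w ∈ W}`. -/
def twistedIdentities (θ : W ≃* W) : Set W := {w | ∃ v : W, w = θ v⁻¹ * v}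

/-- The rank `ρ(w)` of a twisted involution: the least `k` such that
`w = e ⋅ s̲₁ ⋯ s̲ₖ`. -/
noncomputable def twistRank (cs : CoxeterSystem M W) (θ : W ≃* W) (w : W) : ℕ :=
  sInf {k | ∃ l : List B, l.length = k ∧ twistProd cs θ l = w}

/-- `θ` has the no-odd-flip (NOF) property: for every `s ∈ S` with `θ(s) ≠ s`,
the order of `s θ(s)` is even or infinite. -/
def NOF (cs : CoxeterSystem M W) (θ : W ≃* W) : Prop :=
  ∀ i : B, θ (cs.simple i) ≠ cs.simple i →
    Even (orderOf (cs.simple i * θ (cs.simple i))) ∨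
      orderOf (cs.simple i * θ (cs.simple i)) = 0

open CoxeterSystem List

/-! ### The strong exchange property -/

section StrongExchange

variable (cs : CoxeterSystem M W)

/-- The permutation `(t, e) ↦ (sᵢ t sᵢ, e + [t = sᵢ])` of `W × ZMod 2`. -/
noncomputable def signedConj (i : B) : Equiv.Perm (W × ZMod 2) :=
  Function.Involutive.toPerm
    (fun p ↦ (cs.simple i * p.1 * cs.simple i, p.2 + if p.1 = cs.simple i then 1 else 0)) <| by
    rintro ⟨t, e⟩
    have h : cs.simple i * t * cs.simple i = cs.simple i ↔ t = cs.simple i := by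
      constructor
      · intro h
        have := congrArg (fun x ↦ cs.simple i * x * cs.simple i) h
        simpa [mul_assoc] using this
      · rintro rfl; simp
    ext
    · simp [mul_assoc]
    · simp only [h, add_assoc]
      split_ifs <;> simp [CharTwo.add_self_eq_zero]

theorem signedConj_apply (i : B) (t : W) (e : ZMod 2) :
    signedConj cs i (t, e) =
      (cs.simple i * t * cs.simple i, e + if t = cs.simple i then 1 else 0) := rfl

theorem simple_mul_pow_eq (i j : B) (n : ℕ) :
    ((cs.simple i * cs.simple j) ^ n)⁻¹ * cs.simple j =
      cs.simple j * (cs.simple i * cs.simple j) ^ n := by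
  induction n with
  | zero => simp
  | succ n ih =>
    calc ((cs.simple i * cs.simple j) ^ (n + 1))⁻¹ * cs.simple j
        = (cs.simple i * cs.simple j)⁻¹ *
            (((cs.simple i * cs.simple j) ^ n)⁻¹ * cs.simple j) := by
          rw [pow_succ, mul_inv_rev, mul_assoc]
      _ = _ := by rw [ih, pow_succ']; simp [mul_assoc]

theorem signedConj_mul_pow_apply (i j : B) (n : ℕ) (t : W) (e : ZMod 2) :
    ((signedConj cs i * signedConj cs j) ^ n) (t, e) =
      ((cs.simple i * cs.simple j) ^ n * t * ((cs.simple i * cs.simple j) ^ n)⁻¹,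
        e + ∑ k ∈ Finset.range (2 * n),
          if t = cs.simple j * (cs.simple i * cs.simple j) ^ k then 1 else 0) := by
  induction n with
  | zero => simp
  | succ n ih =>
    rw [pow_succ', Equiv.Perm.mul_apply, ih, Equiv.Perm.mul_apply, signedConj_apply,
      signedConj_apply, show 2 * (n + 1) = 2 * n + 1 + 1 by ring, Finset.sum_range_succ,
      Finset.sum_range_succ]
    set c := cs.simple i * cs.simple j with hc
    have hj := simple_mul_pow_eq cs i j n
    rw [← hc] at hj
    have h1 : c ^ n * t * (c ^ n)⁻¹ = cs.simple j ↔ t = cs.simple j * c ^ (2 * n) := by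
      rw [two_mul, pow_add, ← mul_assoc, ← hj]
      constructor
      · intro h; rw [← h]; group
      · intro h; rw [h]; group
    have h2 : cs.simple j * (c ^ n * t * (c ^ n)⁻¹) * cs.simple j = cs.simple i ↔
        t = cs.simple j * c ^ (2 * n + 1) := by
      have h3 : cs.simple j * c ^ (2 * n + 1) =
          (c ^ n)⁻¹ * (cs.simple j * cs.simple i * cs.simple j) * c ^ n := by
        rw [show 2 * n + 1 = n + (1 + n) by ring, pow_add, pow_add, pow_one, ← mul_assoc, ← hj, hc]
        simp only [mul_assoc]
      rw [h3]
      constructor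
      · intro h; rw [← h]; simp [mul_assoc]
      · intro h; rw [h]; simp [mul_assoc]
    simp only [h1, h2]
    ext
    · simp only [pow_succ', mul_inv_rev, hc]; simp [mul_assoc]
    · simp only [add_assoc]

theorem signedConj_isLiftable : M.IsLiftable (signedConj cs) := by
  intro i j
  ext1 ⟨t, e⟩
  rw [signedConj_mul_pow_apply, two_mul, Finset.sum_range_add]
  simp [pow_add, CharTwo.add_self_eq_zero]

/-- The action of `W` on `W × ZMod 2` lifting `signedConj`. -/
noncomputable def signedConjHom : W →* Equiv.Perm (W × ZMod 2) :=
  cs.lift ⟨signedConj cs, signedConj_isLiftable cs⟩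

theorem signedConjHom_simple (i : B) : signedConjHom cs (cs.simple i) = signedConj cs i :=
  cs.lift_apply_simple (signedConj_isLiftable cs) i

theorem signedConjHom_wordProd (ω : List B) (t : W) (e : ZMod 2) :
    signedConjHom cs (cs.wordProd ω) (t, e) =
      (cs.wordProd ω * t * (cs.wordProd ω)⁻¹, e + ((cs.rightInvSeq ω).count t : ZMod 2)) := by
  induction ω with
  | nil => simp
  | cons i ω ih =>
    have h : cs.wordProd ω * t * (cs.wordProd ω)⁻¹ = cs.simple i ↔
        (cs.wordProd ω)⁻¹ * cs.simple i * cs.wordProd ω = t := by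
      constructor
      · intro h; rw [← h]; group
      · rintro rfl; group
    rw [wordProd_cons, map_mul, Equiv.Perm.mul_apply, ih, signedConjHom_simple, signedConj_apply,
      rightInvSeq, List.count_cons]
    ext
    · simp [mul_assoc]
    · simp [h, add_assoc]

theorem signedConjHom_add (w t : W) (e f : ZMod 2) :
    signedConjHom cs w (t, e + f) =
      ((signedConjHom cs w (t, e)).1, (signedConjHom cs w (t, e)).2 + f) := by
  obtain ⟨ω, rfl⟩ := cs.wordProd_surjective w
  simp only [signedConjHom_wordProd]
  ext
  · rfl
  · simp only; ring

theorem signedConjHom_fst (w t : W) (e : ZMod 2) :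
    (signedConjHom cs w (t, e)).1 = w * t * w⁻¹ := by
  obtain ⟨ω, rfl⟩ := cs.wordProd_surjective w
  simp only [signedConjHom_wordProd]

theorem signedConjHom_reflection {t : W} (ht : cs.IsReflection t) :
    signedConjHom cs t (t, 0) = (t, 1) := by
  obtain ⟨v, i, rfl⟩ := ht
  set t := v * cs.simple i * v⁻¹ with htd
  obtain ⟨e, he⟩ : ∃ e, signedConjHom cs v⁻¹ (t, 0) = (cs.simple i, e) :=
    ⟨_, Prod.ext (by rw [signedConjHom_fst, htd]; group) rfl⟩
  have hv : signedConjHom cs v (cs.simple i, e) = (t, 0) := by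
    rw [← he, ← Equiv.Perm.mul_apply, ← map_mul]; simp
  have : signedConjHom cs t (t, 0) =
      signedConjHom cs v (signedConjHom cs (cs.simple i) (signedConjHom cs v⁻¹ (t, 0))) := by
    rw [← Equiv.Perm.mul_apply, ← Equiv.Perm.mul_apply, ← map_mul, ← map_mul]
  rw [this, he, signedConjHom_simple, signedConj_apply]
  simp [signedConjHom_add, hv]

theorem mem_rightInvSeq_of_isRightInversion {ω : List B} {t : W}
    (h : cs.IsRightInversion (cs.wordProd ω) t) : t ∈ cs.rightInvSeq ω := by
  by_contra hmem
  obtain ⟨η, hη, hηw⟩ := cs.exists_isReduced (cs.wordProd ω * t)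
  have h1 : signedConjHom cs (cs.wordProd ω * t) (t, 0) =
      (cs.wordProd ω * t * (cs.wordProd ω)⁻¹, 1) := by
    rw [map_mul, Equiv.Perm.mul_apply, signedConjHom_reflection cs h.1, signedConjHom_wordProd,
      List.count_eq_zero_of_not_mem hmem]
    simp
  rw [hηw, signedConjHom_wordProd] at h1
  have h2 : t ∈ cs.rightInvSeq η := by
    by_contra hmem'
    have := congrArg Prod.snd h1
    simp [List.count_eq_zero_of_not_mem hmem'] at this
  have h3 := cs.isRightInversion_of_mem_rightInvSeq hη h2
  rw [← hηw] at h3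
  exact h.1.isRightInversion_mul_left_iff.1 h3 h

theorem strong_exchange {ω : List B} {t : W} (h : cs.IsRightInversion (cs.wordProd ω) t) :
    ∃ j < ω.length, cs.wordProd ω * t = cs.wordProd (ω.eraseIdx j) := by
  obtain ⟨j, hj, rfl⟩ := List.mem_iff_getElem.1 (mem_rightInvSeq_of_isRightInversion cs h)
  refine ⟨j, by simpa using hj, ?_⟩
  rw [← wordProd_mul_getD_rightInvSeq, List.getD_eq_getElem]

end StrongExchange

/-! ### The Bruhat order as generated by reflections -/

section Bruhat

variable (cs : CoxeterSystem M W)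

theorem length_mul_lt_of_ne {u t : W} {i : B} (ht : cs.IsReflection t) (hti : t ≠ cs.simple i)
    (h : cs.length u < cs.length (u * t)) :
    cs.length (u * cs.simple i) < cs.length (u * t * cs.simple i) := by
  by_contra hle
  have hconj : u * t * cs.simple i =
      u * cs.simple i * (cs.simple i * t * (cs.simple i)⁻¹) := by simp [mul_assoc]
  have hr : cs.IsReflection (cs.simple i * t * (cs.simple i)⁻¹) := ht.conj _
  have hlt : cs.length (u * t * cs.simple i) < cs.length (u * cs.simple i) :=
    lt_of_le_of_ne (not_lt.1 hle) (hconj ▸ hr.length_mul_left_ne (u * cs.simple i))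
  have h1 := cs.length_mul_simple u i
  have h2 := cs.length_mul_simple (u * t) i
  obtain ⟨η, hη, hu⟩ := cs.exists_isReduced u
  have hword : cs.wordProd (η ++ [i]) = u * cs.simple i := by simp [wordProd_append, ← hu]
  obtain ⟨j, hj, hje⟩ := strong_exchange cs (ω := η ++ [i])
    (t := cs.simple i * t * (cs.simple i)⁻¹)
    ⟨hr, by rw [hword, ← hconj]; exact hlt⟩
  rw [hword, ← hconj] at hje
  have hlen : cs.length u = η.length := by rw [hu, hη.eq]
  rcases lt_or_ge j η.length with hjη | hjη
  · rw [List.eraseIdx_append_of_lt_length hjη, wordProd_append, wordProd_singleton,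
      mul_left_inj] at hje
    have := cs.length_wordProd_le (η.eraseIdx j)
    rw [← hje, List.length_eraseIdx_of_lt hjη] at this
    omega
  · have hj' : j = η.length := by simp at hj; omega
    subst hj'
    rw [List.eraseIdx_append_of_length_le le_rfl] at hje
    simp only [Nat.sub_self, List.eraseIdx_cons_zero, List.append_nil, ← hu] at hje
    apply hti
    have : t * cs.simple i = 1 := by simpa [mul_assoc] using hje
    rw [eq_inv_of_mul_eq_one_left this, cs.inv_simple]

/-- `w` is obtained from `u` by a length-increasing multiplication by a reflection. -/
def BruhatStep (u w : W) : Prop :=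
  ∃ t, cs.IsReflection t ∧ w = u * t ∧ cs.length u < cs.length w

/-- The Bruhat order, as the reflexive transitive closure of `BruhatStep`. -/
def Bruhat : W → W → Prop := Relation.ReflTransGen (BruhatStep cs)

variable {cs}

theorem Bruhat.refl (w : W) : Bruhat cs w w := Relation.ReflTransGen.refl

theorem Bruhat.trans {u v w : W} (h : Bruhat cs u v) (h' : Bruhat cs v w) : Bruhat cs u w :=
  Relation.ReflTransGen.trans h h'

theorem BruhatStep.bruhat {u w : W} (h : BruhatStep cs u w) : Bruhat cs u w :=
  Relation.ReflTransGen.single h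

theorem bruhat_mul_simple {w : W} {i : B} (h : cs.length w < cs.length (w * cs.simple i)) :
    Bruhat cs w (w * cs.simple i) :=
  BruhatStep.bruhat ⟨_, cs.isReflection_simple i, rfl, h⟩

theorem mul_simple_bruhat {w : W} {i : B} (h : cs.length (w * cs.simple i) < cs.length w) :
    Bruhat cs (w * cs.simple i) w :=
  BruhatStep.bruhat ⟨_, cs.isReflection_simple i, by simp, h⟩

theorem Bruhat.eq_or_length_lt {u w : W} (h : Bruhat cs u w) :
    u = w ∨ cs.length u < cs.length w := by
  induction h with
  | refl => exact .inl rfl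
  | tail _ hstep ih =>
    obtain ⟨t, _, _, hlt⟩ := hstep
    rcases ih with rfl | ih
    · exact .inr hlt
    · exact .inr (ih.trans hlt)

theorem Bruhat.inv {u w : W} (h : Bruhat cs u w) : Bruhat cs u⁻¹ w⁻¹ := by
  refine Relation.ReflTransGen.lift (f := fun x ↦ x⁻¹) ?_ _ _ h
  rintro a b ⟨t, ht, rfl, hlt⟩
  refine ⟨a * t * a⁻¹, ht.conj a, ?_, by simpa only [cs.length_inv] using hlt⟩
  simp [ht.inv, mul_assoc]

variable (cs)

/-- The shorter of `w` and `w * sᵢ`. -/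
noncomputable def rightMin (i : B) (w : W) : W :=
  if cs.length (w * cs.simple i) < cs.length w then w * cs.simple i else w

/-- The longer of `w` and `w * sᵢ`. -/
noncomputable def rightMax (i : B) (w : W) : W :=
  if cs.length (w * cs.simple i) < cs.length w then w else w * cs.simple i

variable {cs}

theorem length_lt_mul_simple {w : W} {i : B}
    (h : ¬cs.length (w * cs.simple i) < cs.length w) :
    cs.length w < cs.length (w * cs.simple i) :=
  lt_of_le_of_ne (not_lt.1 h) (cs.length_mul_simple_ne w i).symm

theorem rightMin_bruhat (i : B) (w : W) :
    Bruhat cs (rightMin cs i w) w ∧ Bruhat cs (rightMin cs i w) (w * cs.simple i) := by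
  unfold rightMin
  split_ifs with h
  · exact ⟨mul_simple_bruhat h, .refl _⟩
  · exact ⟨.refl _, bruhat_mul_simple (length_lt_mul_simple h)⟩

theorem bruhat_rightMax (i : B) (w : W) :
    Bruhat cs w (rightMax cs i w) ∧ Bruhat cs (w * cs.simple i) (rightMax cs i w) := by
  unfold rightMax
  split_ifs with h
  · exact ⟨.refl _, mul_simple_bruhat h⟩
  · exact ⟨bruhat_mul_simple (length_lt_mul_simple h), .refl _⟩

theorem BruhatStep.eq_or_mul_simple {u w : W} (h : BruhatStep cs u w) (i : B) :
    w = u * cs.simple i ∨ Bruhat cs (u * cs.simple i) (w * cs.simple i) := by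
  obtain ⟨t, ht, rfl, hlt⟩ := h
  by_cases hti : t = cs.simple i
  · exact .inl (by rw [hti])
  · refine .inr (BruhatStep.bruhat ⟨cs.simple i * t * (cs.simple i)⁻¹, ht.conj _, ?_,
      length_mul_lt_of_ne cs ht hti hlt⟩)
    simp [mul_assoc]

theorem Bruhat.rightMin_mono {u w : W} (h : Bruhat cs u w) (i : B) :
    Bruhat cs (rightMin cs i u) (rightMin cs i w) := by
  refine Relation.ReflTransGen.lift' (f := rightMin cs i) ?_ _ _ h
  intro a b hab
  change Bruhat cs _ _
  rcases hab.eq_or_mul_simple i with rfl | hs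
  · obtain ⟨t, ht, _, hlt⟩ := hab
    have : rightMin cs i (a * cs.simple i) =
        rightMin cs i a := by
      unfold rightMin
      rw [if_neg (not_lt.2 hlt.le), if_pos (by simpa using hlt)]
      simp
    rw [this]
    exact .refl _
  · conv => arg 3; unfold rightMin
    split_ifs with hb
    · exact (rightMin_bruhat i a).2.trans hs
    · exact (rightMin_bruhat i a).1.trans hab.bruhat

theorem Bruhat.rightMax_mono {u w : W} (h : Bruhat cs u w) (i : B) :
    Bruhat cs (rightMax cs i u) (rightMax cs i w) := by
  refine Relation.ReflTransGen.lift' (f := rightMax cs i) ?_ _ _ h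
  intro a b hab
  change Bruhat cs _ _
  rcases hab.eq_or_mul_simple i with rfl | hs
  · obtain ⟨t, ht, _, hlt⟩ := hab
    have : rightMax cs i (a * cs.simple i) =
        rightMax cs i a := by
      unfold rightMax
      rw [if_neg (not_lt.2 hlt.le), if_pos (by simpa using hlt)]
    rw [this]
    exact .refl _
  · conv => arg 2; unfold rightMax
    split_ifs with ha
    · exact hab.bruhat.trans (bruhat_rightMax i b).1
    · exact hs.trans (bruhat_rightMax i b).2

/-- An element all of whose simple reflections are right descents dominates everything. -/
theorem bruhat_of_forall_descent {x : W}
    (hx : ∀ i, cs.length (x * cs.simple i) < cs.length x) (u : W) : Bruhat cs u x := by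
  have one_le : ∀ w : W, Bruhat cs 1 w := by
    intro w
    induction h : cs.length w using Nat.strong_induction_on generalizing w with
    | _ n ih =>
      by_cases hw : w = 1
      · rw [hw]; exact .refl _
      · obtain ⟨i, hi⟩ := cs.exists_rightDescent_of_ne_one hw
        exact (ih _ (h ▸ hi) _ rfl).trans (mul_simple_bruhat hi)
  refine cs.simple_induction_right (p := fun u ↦ Bruhat cs u x) u (one_le x) fun w i hw ↦ ?_
  have := hw.rightMax_mono i
  rw [show rightMax cs i x = x from if_pos (hx i)] at this
  exact (bruhat_rightMax i w).2.trans this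

theorem eq_of_forall_descent {x w₀ : W} (hw₀ : ∀ w, cs.length w ≤ cs.length w₀)
    (hx : ∀ i, cs.length (x * cs.simple i) < cs.length x) : x = w₀ := by
  rcases (bruhat_of_forall_descent hx w₀).eq_or_length_lt with h | h
  · exact h.symm
  · exact absurd (hw₀ x) (not_le.2 h)

/-- If `x < sⱼx` but `sⱼxsᵢ < xsᵢ`, then `sⱼxsᵢ = x`. -/
theorem simple_mul_mul_simple_eq {x : W} {i j : B}
    (h2 : cs.length x < cs.length (cs.simple j * x))
    (h3 : cs.length (cs.simple j * x * cs.simple i) < cs.length (x * cs.simple i)) :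
    cs.simple j * x * cs.simple i = x := by
  by_contra hne
  have hx : cs.simple j * x = x * (x⁻¹ * cs.simple j * x⁻¹⁻¹) := by simp [mul_assoc]
  have ht : cs.IsReflection (x⁻¹ * cs.simple j * x⁻¹⁻¹) := (cs.isReflection_simple j).conj _
  have := length_mul_lt_of_ne cs (u := x) (i := i) ht
    (by
      intro h
      apply hne
      rw [hx, h]
      simp)
    (by rwa [← hx])
  rw [← hx] at this
  exact lt_asymm this h3

theorem simple_mul_mul_simple_lt {w : W} {i j : B}
    (h2 : cs.length (cs.simple j * w) < cs.length w)
    (h3 : cs.simple j * w * cs.simple i ≠ w) :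
    cs.length (cs.simple j * w * cs.simple i) < cs.length (w * cs.simple i) := by
  by_contra hle
  have h4 : cs.length (w * cs.simple i) < cs.length (cs.simple j * (w * cs.simple i)) := by
    rw [← mul_assoc]
    exact lt_of_le_of_ne (not_lt.1 hle)
      (by rw [mul_assoc]; exact (cs.length_simple_mul_ne _ j).symm)
  have := simple_mul_mul_simple_eq (x := w * cs.simple i) (i := i) (j := j)
    h4 (by simpa [mul_assoc] using h2)
  apply h3
  have h5 : cs.simple j * w = w * cs.simple i := by simpa [mul_assoc] using this
  rw [h5]
  simp

end Bruhat

/-! ### Cosets of dihedral parabolic subgroups -/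

section Dihedral

variable {cs : CoxeterSystem M W}

/-- If `y` has minimal length in its coset `y⟨sᵢ, sⱼ⟩` and `ω` is a shortest word in `{i, j}`
for the element it represents, then lengths add up in the product of `y` and that element. -/
theorem length_mul_wordProd_of_minimal {i j : B} {y : W}
    (hy : ∀ ω : List B, (∀ k ∈ ω, k = i ∨ k = j) → cs.length y ≤ cs.length (y * cs.wordProd ω))
    (ω : List B) (hω : ∀ k ∈ ω, k = i ∨ k = j)
    (hmin : ∀ ω' : List B, (∀ k ∈ ω', k = i ∨ k = j) → cs.wordProd ω' = cs.wordProd ω →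
      ω.length ≤ ω'.length) :
    cs.length (y * cs.wordProd ω) = cs.length y + ω.length := by
  induction ω using List.reverseRecOn with
  | nil => simp
  | append_singleton ω k ih =>
    have hω1 : ∀ l ∈ ω, l = i ∨ l = j := fun l hl ↦ hω l (by simp [hl])
    have hk : k = i ∨ k = j := hω k (by simp)
    have ih := ih hω1 fun ω' hω' he ↦ by
      have := hmin (ω' ++ [k])
        (by simp only [List.mem_append, List.mem_singleton]; rintro l (h | rfl); exacts [hω' l h, hk])
        (by simp [wordProd_append, he])
      simpa using this
    obtain ⟨η, hη, hyη⟩ := cs.exists_isReduced y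
    have hlen : cs.length y = η.length := by rw [hyη, hη.eq]
    rw [wordProd_append, wordProd_singleton, ← mul_assoc]
    rcases cs.length_mul_simple (y * cs.wordProd ω) k with h | h
    · simp [h, ih, add_assoc]
    exfalso
    have hw : cs.wordProd (η ++ ω) = y * cs.wordProd ω := by rw [wordProd_append, hyη]
    obtain ⟨m, hm, he⟩ := strong_exchange cs (ω := η ++ ω) (t := cs.simple k)
      ⟨cs.isReflection_simple k, by rw [hw]; omega⟩
    rw [hw] at he
    rcases lt_or_ge m η.length with hm' | hm'
    · rw [List.eraseIdx_append_of_lt_length hm', wordProd_append] at he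
      have h1 := hy (ω ++ [k] ++ ω.reverse) (by
        simp only [List.mem_append, List.mem_singleton, List.mem_reverse]
        rintro l ((h | rfl) | h)
        exacts [hω1 l h, hk, hω1 l h])
      rw [wordProd_append, wordProd_append, wordProd_singleton, wordProd_reverse, ← mul_assoc,
        ← mul_assoc, he, mul_inv_cancel_right] at h1
      have h2 := cs.length_wordProd_le (η.eraseIdx m)
      rw [List.length_eraseIdx_of_lt hm'] at h2
      omega
    · rw [List.eraseIdx_append_of_length_le hm', wordProd_append, ← hyη, mul_assoc,
        mul_right_inj] at he
      have h1 := hmin (ω.eraseIdx (m - η.length))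
        (fun l hl ↦ hω1 l (List.mem_of_mem_eraseIdx hl)) (by simp [wordProd_append, he])
      have h2 := List.length_eraseIdx_le ω (m - η.length)
      simp at h1
      omega

theorem exists_coset_factorization (i j : B) (t : W) :
    ∃ y : W, ∀ ω₀ : List B, (∀ k ∈ ω₀, k = i ∨ k = j) →
      ∃ ω : List B, (∀ k ∈ ω, k = i ∨ k = j) ∧ t * cs.wordProd ω₀ = y * cs.wordProd ω ∧
        cs.length (t * cs.wordProd ω₀) = cs.length y + ω.length := by
  have hex : ∃ n, ∃ ω : List B, (∀ k ∈ ω, k = i ∨ k = j) ∧ cs.length (t * cs.wordProd ω) = n :=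
    ⟨_, [], by simp, rfl⟩
  obtain ⟨ω₁, hω₁, hn⟩ := Nat.find_spec hex
  have happ : ∀ {ω ω' : List B}, (∀ k ∈ ω, k = i ∨ k = j) → (∀ k ∈ ω', k = i ∨ k = j) →
      ∀ k ∈ ω ++ ω', k = i ∨ k = j := by
    intro ω ω' h h' k hk
    exact (List.mem_append.1 hk).elim (h k) (h' k)
  refine ⟨t * cs.wordProd ω₁, fun ω₀ hω₀ ↦ ?_⟩
  have hex' : ∃ n, ∃ ω : List B, (∀ k ∈ ω, k = i ∨ k = j) ∧
      t * cs.wordProd ω₀ = t * cs.wordProd ω₁ * cs.wordProd ω ∧ ω.length = n :=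
    ⟨_, ω₁.reverse ++ ω₀, happ (by simpa using hω₁) hω₀, by simp [wordProd_append, mul_assoc], rfl⟩
  obtain ⟨ω, hω, he, hlen⟩ := Nat.find_spec hex'
  refine ⟨ω, hω, he, ?_⟩
  rw [he]
  refine length_mul_wordProd_of_minimal (i := i) (j := j) (fun ω' hω' ↦ ?_) ω hω
    fun ω' hω' he' ↦ ?_
  · rw [hn, mul_assoc, ← wordProd_append]
    exact Nat.find_min' hex ⟨_, happ hω₁ hω', rfl⟩
  · rw [hlen]
    exact Nat.find_min' hex' ⟨ω', hω', by rw [he, he'], rfl⟩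

theorem eq_alternatingWord_of_isReduced {i j : B} (ω : List B) (hω : ∀ k ∈ ω, k = i ∨ k = j)
    (hr : cs.IsReduced (ω ++ [j])) : ω ++ [j] = alternatingWord i j (ω.length + 1) := by
  induction ω using List.reverseRecOn generalizing i j with
  | nil => simp [alternatingWord]
  | append_singleton ω k ih =>
    rcases hω k (by simp) with rfl | rfl
    · have hr' : cs.IsReduced (ω ++ [k]) := by
        have := hr.take (ω.length + 1)
        rwa [List.take_left' (by simp)] at this
      rw [alternatingWord_succ, ih (fun l hl ↦ (hω l (by simp [hl])).symm) hr']
      simp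
    · have h1 := cs.length_wordProd_le ω
      have h2 := hr.eq
      simp [wordProd_append, wordProd_cons] at h2
      omega

/-- An element having `i` and `j` as right descents ends with an element of the dihedral group
`⟨sᵢ, sⱼ⟩` on which the two alternating words of the same length agree. -/
theorem exists_alternatingWord_factor {i j : B} {t : W}
    (hi : cs.length (t * cs.simple i) < cs.length t)
    (hj : cs.length (t * cs.simple j) < cs.length t) :
    ∃ (y : W) (k : ℕ), 0 < k ∧
      cs.wordProd (alternatingWord i j k) = cs.wordProd (alternatingWord j i k) ∧
      t = y * cs.wordProd (alternatingWord i j k) ∧ cs.length t = cs.length y + k := by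
  obtain ⟨y, hy⟩ := exists_coset_factorization (cs := cs) i j t
  obtain ⟨ω₁, hω₁, he₁, hl₁⟩ := hy [i] (by simp)
  obtain ⟨ω₂, hω₂, he₂, hl₂⟩ := hy [j] (by simp)
  rw [wordProd_singleton] at he₁ hl₁ he₂ hl₂
  have h1 := cs.length_mul_simple t i
  have h2 := cs.length_mul_simple t j
  have ht₁ : t = y * cs.wordProd (ω₁ ++ [i]) := by
    rw [wordProd_append, ← mul_assoc, ← he₁]; simp
  have ht₂ : t = y * cs.wordProd (ω₂ ++ [j]) := by
    rw [wordProd_append, ← mul_assoc, ← he₂]; simp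
  have hred : ∀ (ω : List B) (l : B), t = y * cs.wordProd (ω ++ [l]) →
      cs.length t = cs.length y + (ω.length + 1) → cs.IsReduced (ω ++ [l]) := by
    intro ω l he hl
    have h3 := cs.length_wordProd_le (ω ++ [l])
    have h4 := cs.length_mul_le y (cs.wordProd (ω ++ [l]))
    rw [← he] at h4
    unfold CoxeterSystem.IsReduced
    simp only [List.length_append, List.length_singleton] at h3 ⊢
    omega
  have h12 : ω₁.length = ω₂.length := by omega
  have ha₁ := eq_alternatingWord_of_isReduced ω₁ (fun l hl ↦ (hω₁ l hl).symm)
    (hred ω₁ i ht₁ (by omega))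
  have ha₂ := eq_alternatingWord_of_isReduced ω₂ hω₂ (hred ω₂ j ht₂ (by omega))
  rw [ha₁, h12] at ht₁
  rw [ha₂] at ht₂
  exact ⟨y, ω₂.length + 1, by omega, mul_left_cancel (ht₂.symm.trans ht₁), ht₂, by omega⟩

theorem pow_eq_one_of_alternatingWord_eq {i j : B} {k : ℕ}
    (h : cs.wordProd (alternatingWord i j k) = cs.wordProd (alternatingWord j i k)) :
    (cs.simple i * cs.simple j) ^ k = 1 := by
  have hinv : cs.simple j * cs.simple i = (cs.simple i * cs.simple j)⁻¹ := by simp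
  rw [prod_alternatingWord_eq_mul_pow, prod_alternatingWord_eq_mul_pow, hinv] at h
  rcases Nat.even_or_odd' k with ⟨m, rfl | rfl⟩
  · simp only [even_two, Even.mul_right, if_true, one_mul, inv_pow] at h
    rw [Nat.mul_div_cancel_left _ two_pos] at h
    rw [two_mul, pow_add]
    nth_rw 1 [h]
    simp
  · rw [if_neg (by simp), if_neg (by simp), show (2 * m + 1) / 2 = m by omega, inv_pow] at h
    rw [show 2 * m + 1 = 1 + m + m by ring, pow_add, pow_add, pow_one, mul_assoc (cs.simple i), h]
    simp

end Dihedral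

/-! ### Twisted involutions -/

section Twisted

variable {cs : CoxeterSystem M W} {θ : W ≃* W}

theorem length_map (hθ : Function.Involutive θ)
    (hθS : ∀ i : B, ∃ j : B, θ (cs.simple i) = cs.simple j) (w : W) :
    cs.length (θ w) = cs.length w := by
  have hle : ∀ w, cs.length (θ w) ≤ cs.length w := by
    intro w
    choose τ hτ using hθS
    obtain ⟨ω, hω, rfl⟩ := cs.exists_isReduced w
    have : θ (cs.wordProd ω) = cs.wordProd (ω.map τ) := by
      simp only [wordProd, map_list_prod, List.map_map]
      congr 1
      exact List.map_congr_left fun i _ ↦ hτ i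
    rw [this, hω.eq]
    simpa using cs.length_wordProd_le (ω.map τ)
  exact (hle w).antisymm (by simpa [hθ w] using hle (θ w))

theorem map_simple_mul_map_simple (i : B) : θ (cs.simple i) * θ (cs.simple i) = 1 := by
  rw [← map_mul]; simp

theorem length_map_simple_mul (hθ : Function.Involutive θ)
    (hθS : ∀ i : B, ∃ j : B, θ (cs.simple i) = cs.simple j) {w : W}
    (hw : w ∈ twistedInvolutions θ) (i : B) :
    cs.length (θ (cs.simple i) * w) = cs.length (w * cs.simple i) := by
  have hw : θ w = w⁻¹ := hw
  rw [← length_map hθ hθS, map_mul, hθ, hw, ← cs.length_inv]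
  simp

theorem twistAct_of_eq {w : W} {i : B} (h : θ (cs.simple i) * w * cs.simple i = w) :
    twistAct cs θ w i = w * cs.simple i := if_pos h

theorem twistAct_of_ne {w : W} {i : B} (h : θ (cs.simple i) * w * cs.simple i ≠ w) :
    twistAct cs θ w i = θ (cs.simple i) * w * cs.simple i := if_neg h

theorem twistAct_twistAct (w : W) (i : B) : twistAct cs θ (twistAct cs θ w i) i = w := by
  by_cases h : θ (cs.simple i) * w * cs.simple i = w
  · rw [twistAct_of_eq h, twistAct_of_eq]
    · simp
    · rw [← mul_assoc, h]
  · have h' : θ (cs.simple i) * (θ (cs.simple i) * w * cs.simple i) * cs.simple i = w := by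
      simp only [← mul_assoc, map_simple_mul_map_simple, one_mul]
      simp
    rw [twistAct_of_ne h, twistAct_of_ne, h']
    rw [h']
    exact Ne.symm h

theorem twistAct_mem (hθ : Function.Involutive θ) {w : W} (hw : w ∈ twistedInvolutions θ)
    (i : B) : twistAct cs θ w i ∈ twistedInvolutions θ := by
  have hw : θ w = w⁻¹ := hw
  change θ _ = _
  have hinv : (θ (cs.simple i))⁻¹ = θ (cs.simple i) := by rw [← map_inv]; simp
  by_cases h : θ (cs.simple i) * w * cs.simple i = w
  · rw [twistAct_of_eq h, map_mul, hw, mul_inv_rev, cs.inv_simple]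
    nth_rw 1 [← h]
    rw [mul_inv_rev, mul_inv_rev, hinv, mul_assoc, mul_assoc, map_simple_mul_map_simple,
      mul_one, cs.inv_simple]
  · rw [twistAct_of_ne h, map_mul, map_mul, hθ, hw, mul_inv_rev, mul_inv_rev, hinv, cs.inv_simple,
      mul_assoc]

theorem length_twistAct_lt (hθ : Function.Involutive θ)
    (hθS : ∀ i : B, ∃ j : B, θ (cs.simple i) = cs.simple j) {w : W}
    (hw : w ∈ twistedInvolutions θ) {i : B}
    (h : cs.length (w * cs.simple i) < cs.length w) :
    cs.length (twistAct cs θ w i) < cs.length w := by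
  by_cases he : θ (cs.simple i) * w * cs.simple i = w
  · rwa [twistAct_of_eq he]
  · have h' := length_map_simple_mul hθ hθS hw i
    obtain ⟨j, hj⟩ := hθS i
    rw [twistAct_of_ne he]
    rw [hj] at he h' ⊢
    exact (simple_mul_mul_simple_lt (by omega) he).trans h

theorem length_lt_twistAct (hθ : Function.Involutive θ)
    (hθS : ∀ i : B, ∃ j : B, θ (cs.simple i) = cs.simple j) {w : W}
    (hw : w ∈ twistedInvolutions θ) {i : B}
    (h : cs.length w < cs.length (w * cs.simple i)) :
    cs.length w < cs.length (twistAct cs θ w i) := by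
  by_cases he : θ (cs.simple i) * w * cs.simple i = w
  · rwa [twistAct_of_eq he]
  · have h' := length_map_simple_mul hθ hθS hw i
    obtain ⟨j, hj⟩ := hθS i
    rw [twistAct_of_ne he]
    rw [hj] at he h' ⊢
    by_contra hlt
    exact he (simple_mul_mul_simple_eq (by omega) (by omega))

theorem length_twistAct_lt_iff (hθ : Function.Involutive θ)
    (hθS : ∀ i : B, ∃ j : B, θ (cs.simple i) = cs.simple j) {w : W}
    (hw : w ∈ twistedInvolutions θ) {i : B} :
    cs.length (twistAct cs θ w i) < cs.length w ↔
      cs.length (w * cs.simple i) < cs.length w := by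
  refine ⟨fun h ↦ ?_, length_twistAct_lt hθ hθS hw⟩
  by_contra h'
  exact lt_asymm h (length_lt_twistAct hθ hθS hw (length_lt_mul_simple h'))

/-- The shorter of `w` and `w ⋅ s̲ᵢ`. -/
noncomputable def twistMin (cs : CoxeterSystem M W) (θ : W ≃* W) (i : B) (w : W) : W :=
  if cs.length (twistAct cs θ w i) < cs.length w then twistAct cs θ w i else w

theorem twistMin_eq (hθ : Function.Involutive θ)
    (hθS : ∀ i : B, ∃ j : B, θ (cs.simple i) = cs.simple j) {w : W}
    (hw : w ∈ twistedInvolutions θ) {i j : B} (hj : θ (cs.simple i) = cs.simple j) :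
    twistMin cs θ i w = (rightMin cs j (rightMin cs i w)⁻¹)⁻¹ := by
  have hlen := length_map_simple_mul hθ hθS hw i
  rw [hj] at hlen
  have hleft : ∀ x : W, cs.length (x⁻¹ * cs.simple j) = cs.length (cs.simple j * x) := by
    intro x
    rw [← cs.length_inv]; simp
  unfold twistMin
  simp only [length_twistAct_lt_iff hθ hθS hw]
  unfold rightMin
  split_ifs with h1 h2 h3
  · rw [hleft, cs.length_inv, ← mul_assoc] at h2
    rw [twistAct_of_ne, hj]
    · simp [mul_assoc]
    · intro he
      rw [hj] at he
      rw [he] at h2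
      exact lt_asymm h1 h2
  · rw [hleft, cs.length_inv, ← mul_assoc] at h2
    rw [twistAct_of_eq, inv_inv]
    by_contra he
    rw [hj] at he
    exact h2 (simple_mul_mul_simple_lt (by omega) he)
  · rw [hleft, cs.length_inv] at h3
    omega
  · simp

theorem Bruhat.twistMin_mono (hθ : Function.Involutive θ)
    (hθS : ∀ i : B, ∃ j : B, θ (cs.simple i) = cs.simple j) {u w : W}
    (hu : u ∈ twistedInvolutions θ) (hw : w ∈ twistedInvolutions θ)
    (h : Bruhat cs u w) (i : B) : Bruhat cs (twistMin cs θ i u) (twistMin cs θ i w) := by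
  obtain ⟨j, hj⟩ := hθS i
  rw [twistMin_eq hθ hθS hu hj, twistMin_eq hθ hθS hw hj]
  exact (((h.rightMin_mono i).inv).rightMin_mono j).inv

theorem twistMin_bruhat (hθ : Function.Involutive θ)
    (hθS : ∀ i : B, ∃ j : B, θ (cs.simple i) = cs.simple j) {w : W}
    (hw : w ∈ twistedInvolutions θ) (i : B) : Bruhat cs (twistMin cs θ i w) w := by
  obtain ⟨j, hj⟩ := hθS i
  rw [twistMin_eq hθ hθS hw hj]
  simpa using ((rightMin_bruhat j (rightMin cs i w)⁻¹).1.inv).trans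
    (by simpa using (rightMin_bruhat i w).1)

theorem one_mem_twistedInvolutions : (1 : W) ∈ twistedInvolutions θ := by
  simp [twistedInvolutions]

/-- `Ascends cs θ l w` says that `w = e ⋅ s̲₁ ⋯ s̲ₖ` for the word `l = s₁ ⋯ sₖ`, with the length
increasing at every step. -/
inductive Ascends (cs : CoxeterSystem M W) (θ : W ≃* W) : List B → W → Prop
  | nil : Ascends cs θ [] 1
  | snoc {l : List B} {w : W} (i : B) (h : Ascends cs θ l w)
      (hlt : cs.length w < cs.length (twistAct cs θ w i)) :
      Ascends cs θ (l ++ [i]) (twistAct cs θ w i)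

theorem twistProd_append_singleton (l : List B) (i : B) :
    twistProd cs θ (l ++ [i]) = twistAct cs θ (twistProd cs θ l) i := by
  simp [twistProd]

theorem Ascends.twistProd_eq {l : List B} {w : W} (h : Ascends cs θ l w) :
    twistProd cs θ l = w := by
  induction h with
  | nil => rfl
  | snoc i _ _ ih => rw [twistProd_append_singleton, ih]

theorem Ascends.mem (hθ : Function.Involutive θ) {l : List B} {w : W} (h : Ascends cs θ l w) :
    w ∈ twistedInvolutions θ := by
  induction h with
  | nil => exact one_mem_twistedInvolutions
  | snoc i _ _ ih => exact twistAct_mem hθ ih i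

theorem exists_ascends (hθ : Function.Involutive θ)
    (hθS : ∀ i : B, ∃ j : B, θ (cs.simple i) = cs.simple j) {w : W}
    (hw : w ∈ twistedInvolutions θ) : ∃ l, Ascends cs θ l w := by
  induction h : cs.length w using Nat.strong_induction_on generalizing w with
  | _ n ih =>
    by_cases h1 : w = 1
    · exact ⟨[], h1 ▸ .nil⟩
    · obtain ⟨i, hi⟩ := cs.exists_rightDescent_of_ne_one h1
      have hlt := length_twistAct_lt hθ hθS hw hi
      obtain ⟨l, hl⟩ := ih _ (h ▸ hlt) (twistAct_mem hθ hw i) rfl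
      have := hl.snoc i (by rwa [twistAct_twistAct])
      rw [twistAct_twistAct] at this
      exact ⟨_, this⟩

/-- The number of steps of an ascending word is monotone with respect to the Bruhat order. -/
theorem Ascends.length_le_length (hθ : Function.Involutive θ)
    (hθS : ∀ i : B, ∃ j : B, θ (cs.simple i) = cs.simple j) {u w : W} {p q : List B}
    (hp : Ascends cs θ p u) (hq : Ascends cs θ q w) (huw : Bruhat cs u w) :
    p.length ≤ q.length ∧ (u ≠ w → p.length < q.length) := by
  induction hn : cs.length w using Nat.strong_induction_on generalizing u w p q with
  | _ n ih =>
    have strict : ∀ {u : W} {p : List B}, Ascends cs θ p u → Bruhat cs u w → u ≠ w →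
        p.length < q.length := by
      intro u p hp huw hne
      have hlen : cs.length u < cs.length w := huw.eq_or_length_lt.resolve_left hne
      cases hq with
      | nil => simp at hlen
      | @snoc q v i hq hlt =>
        have hmin : twistMin cs θ i (twistAct cs θ v i) = v := by
          unfold twistMin
          rw [twistAct_twistAct, if_pos hlt]
        have huv := huw.twistMin_mono hθ hθS (hp.mem hθ) (twistAct_mem hθ (hq.mem hθ) i) i
        rw [hmin] at huv
        rw [List.length_append, List.length_singleton]
        unfold twistMin at huv
        split_ifs at huv with hu
        · obtain ⟨p', hp'⟩ := exists_ascends hθ hθS (twistAct_mem hθ (hp.mem hθ) i)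
          have h1 := (ih _ (hn ▸ hlt) hp' hq huv rfl).2 (by
            rintro rfl
            exact hne (twistAct_twistAct u i).symm)
          have h2 := hp'.snoc i (by rwa [twistAct_twistAct])
          rw [twistAct_twistAct] at h2
          have h3 := (ih _ (hn ▸ hlen) hp h2 (.refl u) rfl).1
          rw [List.length_append, List.length_singleton] at h3
          omega
        · have := (ih _ (hn ▸ hlt) hp hq huv rfl).1
          omega
    refine ⟨?_, strict hp huw⟩
    by_cases hne : u = w
    · subst hne
      cases hp with
      | nil => simp
      | @snoc p v i hp hlt =>
        have hvw : Bruhat cs v (twistAct cs θ v i) := by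
          have := twistMin_bruhat hθ hθS (twistAct_mem (cs := cs) hθ (hp.mem hθ) i) i
          unfold twistMin at this
          rwa [twistAct_twistAct, if_pos hlt] at this
        have := strict hp hvw (fun h ↦ by rw [← h] at hlt; exact lt_irrefl _ hlt)
        simpa using this
    · exact (strict hp huw hne).le

theorem Ascends.length_eq (hθ : Function.Involutive θ)
    (hθS : ∀ i : B, ∃ j : B, θ (cs.simple i) = cs.simple j) {w : W} {p q : List B}
    (hp : Ascends cs θ p w) (hq : Ascends cs θ q w) : p.length = q.length :=
  (hp.length_le_length hθ hθS hq (.refl w)).1.antisymm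
    (hq.length_le_length hθ hθS hp (.refl w)).1

theorem twistAct_length_ne (hθ : Function.Involutive θ)
    (hθS : ∀ i : B, ∃ j : B, θ (cs.simple i) = cs.simple j) {w : W}
    (hw : w ∈ twistedInvolutions θ) (i : B) :
    cs.length (twistAct cs θ w i) ≠ cs.length w := by
  rcases (cs.length_mul_simple_ne w i).lt_or_gt with h | h
  · exact (length_twistAct_lt hθ hθS hw h).ne
  · exact (length_lt_twistAct hθ hθS hw h).ne'

theorem exists_ascends_length_le (hθ : Function.Involutive θ)
    (hθS : ∀ i : B, ∃ j : B, θ (cs.simple i) = cs.simple j) (l : List B) :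
    ∃ p, Ascends cs θ p (twistProd cs θ l) ∧ p.length ≤ l.length := by
  induction l using List.reverseRecOn with
  | nil => exact ⟨[], .nil, le_rfl⟩
  | append_singleton l i ih =>
    obtain ⟨p, hp, hle⟩ := ih
    rw [twistProd_append_singleton, List.length_append, List.length_singleton]
    rcases (twistAct_length_ne hθ hθS (hp.mem hθ) i).lt_or_gt with h | h
    · obtain ⟨q, hq⟩ := exists_ascends hθ hθS (twistAct_mem hθ (hp.mem hθ) i)
      have h2 := hq.snoc i (by rwa [twistAct_twistAct])
      rw [twistAct_twistAct] at h2
      have := h2.length_eq hθ hθS hp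
      rw [List.length_append, List.length_singleton] at this
      exact ⟨q, hq, by omega⟩
    · exact ⟨p ++ [i], hp.snoc i h, by simpa using hle⟩

/-- The length of an ascending word for `w` is the rank of `w`. -/
theorem Ascends.length_eq_twistRank (hθ : Function.Involutive θ)
    (hθS : ∀ i : B, ∃ j : B, θ (cs.simple i) = cs.simple j) {w : W} {p : List B}
    (hp : Ascends cs θ p w) : p.length = twistRank cs θ w := by
  obtain ⟨l, hl, hlw⟩ : ∃ l : List B, l.length = twistRank cs θ w ∧ twistProd cs θ l = w :=
    Nat.sInf_mem (s := {k | ∃ l : List B, l.length = k ∧ twistProd cs θ l = w})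
      ⟨_, p, rfl, hp.twistProd_eq⟩
  obtain ⟨q, hq, hle⟩ := exists_ascends_length_le (cs := cs) hθ hθS l
  rw [hlw] at hq
  refine le_antisymm ?_ (Nat.sInf_le ⟨p, rfl, hp.twistProd_eq⟩)
  rw [← hl, hp.length_eq hθ hθS hq]
  exact hle

/-- Every ascending word extends to an ascending word for the longest element. -/
theorem Ascends.exists_append (hθ : Function.Involutive θ)
    (hθS : ∀ i : B, ∃ j : B, θ (cs.simple i) = cs.simple j) {w₀ : W}
    (hw₀ : ∀ w, cs.length w ≤ cs.length w₀) {w : W} {p : List B} (hp : Ascends cs θ p w) :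
    ∃ l, Ascends cs θ (p ++ l) w₀ := by
  induction hn : cs.length w₀ - cs.length w using Nat.strong_induction_on generalizing w p with
  | _ n ih =>
    by_cases h : ∀ i, cs.length (w * cs.simple i) < cs.length w
    · exact ⟨[], by rwa [List.append_nil, ← eq_of_forall_descent hw₀ h]⟩
    · obtain ⟨i, hi⟩ := not_forall.1 h
      have hlt := length_lt_twistAct hθ hθS (hp.mem hθ) (length_lt_mul_simple hi)
      have hle := hw₀ (twistAct cs θ w i)
      obtain ⟨l, hl⟩ := ih _ (by omega) (hp.snoc i hlt) rfl
      exact ⟨i :: l, by simpa using hl⟩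

/-- If `w` and all twisted involutions shorter than `w` have even length, then `w` is a twisted
identity `θ(v⁻¹) v` with `2 ℓ(v) ≤ ℓ(w)`. -/
theorem exists_eq_map_inv_mul (hθ : Function.Involutive θ)
    (hθS : ∀ i : B, ∃ j : B, θ (cs.simple i) = cs.simple j) {w : W}
    (hw : w ∈ twistedInvolutions θ) (heven : Even (cs.length w))
    (hmin : ∀ u ∈ twistedInvolutions θ, cs.length u < cs.length w → Even (cs.length u)) :
    ∃ v : W, w = (θ v)⁻¹ * v ∧ 2 * cs.length v ≤ cs.length w := by
  induction hn : cs.length w using Nat.strong_induction_on generalizing w with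
  | _ n ih =>
    by_cases h1 : w = 1
    · exact ⟨1, by simp [h1], by simp⟩
    · obtain ⟨i, hi⟩ := cs.exists_rightDescent_of_ne_one h1
      have hmem := twistAct_mem (cs := cs) hθ hw i
      have hlt := length_twistAct_lt hθ hθS hw hi
      have hev := hmin _ hmem hlt
      have hi' := cs.isRightDescent_iff.1 hi
      by_cases he : θ (cs.simple i) * w * cs.simple i = w
      · rw [twistAct_of_eq he] at hev
        rw [← hi', Nat.even_add_one] at heven
        exact absurd hev heven
      · obtain ⟨v, hv, hlv⟩ := ih _ (hn ▸ hlt) hmem hev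
          (fun u hu hul ↦ hmin u hu (hul.trans hlt)) rfl
        rw [twistAct_of_ne he] at hv
        refine ⟨v * cs.simple i, ?_, ?_⟩
        · rw [map_mul, mul_inv_rev, mul_assoc, ← mul_assoc _ v, ← hv, ← map_inv, cs.inv_simple]
          simp only [← mul_assoc, map_simple_mul_map_simple, one_mul]
          simp
        · have h2 := cs.length_mul_le v (cs.simple i)
          rw [cs.length_simple] at h2
          rcases hev with ⟨a, ha⟩
          rcases heven with ⟨b, hb⟩
          omega

/-- If `θ` has the NOF property and some twisted involution has odd length, then `θ` fixes a
simple reflection. -/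
theorem exists_map_simple_eq (hθ : Function.Involutive θ)
    (hθS : ∀ i : B, ∃ j : B, θ (cs.simple i) = cs.simple j) (hNOF : NOF cs θ)
    (hodd : ∃ w ∈ twistedInvolutions θ, Odd (cs.length w)) :
    ∃ i : B, θ (cs.simple i) = cs.simple i := by
  have hex : ∃ n, ∃ w ∈ twistedInvolutions θ, Odd (cs.length w) ∧ cs.length w = n := by
    obtain ⟨w, hw, ho⟩ := hodd
    exact ⟨_, w, hw, ho, rfl⟩
  obtain ⟨w, hw, hwo, hwn⟩ := Nat.find_spec hex
  have hmin : ∀ u ∈ twistedInvolutions θ, Odd (cs.length u) → cs.length w ≤ cs.length u := by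
    intro u hu huo
    rw [hwn]
    exact Nat.find_min' hex ⟨u, hu, huo, rfl⟩
  clear hwn
  -- In a shortest element of odd length, all descents act by one-sided multiplication.
  have hcomm : ∀ x ∈ twistedInvolutions θ, Odd (cs.length x) → cs.length x ≤ cs.length w →
      ∀ i, cs.length (x * cs.simple i) < cs.length x →
        θ (cs.simple i) * x * cs.simple i = x := by
    intro x hx hxo hxw i hi
    by_contra he
    have hlt := length_twistAct_lt hθ hθS hx hi
    have ho : Odd (cs.length (twistAct cs θ x i)) := by
      rw [twistAct_of_ne he]
      obtain ⟨j, hj⟩ := hθS i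
      have h1 := cs.length_mul_mod_two (cs.simple j * x) (cs.simple i)
      have h2 := cs.length_mul_mod_two (cs.simple j) x
      rw [cs.length_simple] at h1 h2
      rw [hj, Nat.odd_iff]
      rw [Nat.odd_iff] at hxo
      omega
    have := hmin _ (twistAct_mem hθ hx i) ho
    omega
  -- Replace `w` by a reflection fixed by `θ`.
  obtain ⟨t, htfix, htt, hto, htw⟩ : ∃ t : W, θ t = t ∧ t * t = 1 ∧ Odd (cs.length t) ∧
      cs.length t ≤ cs.length w := by
    have hw1 : w ≠ 1 := by rintro rfl; simp at hwo
    obtain ⟨i, hi⟩ := cs.exists_rightDescent_of_ne_one hw1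
    have he := hcomm w hw hwo le_rfl i hi
    have hi' := cs.isRightDescent_iff.1 hi
    have hmem := twistAct_mem (cs := cs) hθ hw i
    rw [twistAct_of_eq he] at hmem
    obtain ⟨v, hv, hlv⟩ := exists_eq_map_inv_mul hθ hθS hmem
      (by rw [← Nat.not_odd_iff_even]; intro ho; have := hmin _ hmem ho; omega)
      (fun u hu hul ↦ by
        rw [← Nat.not_odd_iff_even]; intro ho; have := hmin _ hu ho; omega)
    have ht : cs.IsReflection (v * cs.simple i * v⁻¹) := (cs.isReflection_simple i).conj v
    refine ⟨v * cs.simple i * v⁻¹, ?_, ht.mul_self, ht.odd_length, ?_⟩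
    · have h1 : θ (cs.simple i) * (θ v)⁻¹ * v = (θ v)⁻¹ * v * cs.simple i := by
        rw [mul_assoc, ← hv, ← mul_assoc, he]; simp
      have h2 : θ (cs.simple i) * (θ v)⁻¹ = (θ v)⁻¹ * v * cs.simple i * v⁻¹ := by
        rw [← h1]; simp
      rw [map_mul, map_mul, map_inv, mul_assoc, h2]
      simp [mul_assoc]
    · have h1 := cs.length_mul_le (v * cs.simple i) v⁻¹
      have h2 := cs.length_mul_le v (cs.simple i)
      rw [cs.length_inv] at h1
      rw [cs.length_simple] at h2
      omega
  have htinv : t⁻¹ = t := inv_eq_of_mul_eq_one_left htt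
  have htmem : t ∈ twistedInvolutions θ := by
    change θ t = t⁻¹
    rw [htfix, htinv]
  have ht1 : t ≠ 1 := by rintro rfl; simp at hto
  obtain ⟨i, hi⟩ := cs.exists_rightDescent_of_ne_one ht1
  have he := hcomm t htmem hto htw i hi
  by_contra hnone
  obtain ⟨j, hj⟩ := hθS i
  have hne : θ (cs.simple i) ≠ cs.simple i := fun h ↦ hnone ⟨i, h⟩
  have hdj : cs.length (t * cs.simple j) < cs.length t := by
    rw [← hj, ← length_map hθ hθS, map_mul, htfix, hθ]
    exact hi
  obtain ⟨y, k, hk, hkk, hty, hlen⟩ := exists_alternatingWord_factor hi hdj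
  have hpow := pow_eq_one_of_alternatingWord_eq hkk
  have hkeven : Even k := by
    have hdvd := orderOf_dvd_of_pow_eq_one hpow
    rw [← hj] at hdvd
    rcases hNOF i hne with h | h
    · exact h.trans_dvd hdvd
    · rw [h, zero_dvd_iff] at hdvd
      simp [hdvd]
  obtain ⟨m, rfl⟩ := hkeven.exists_two_nsmul
  rw [smul_eq_mul] at *
  set c := cs.simple i * cs.simple j with hc
  have hcinv : cs.simple j * cs.simple i = c⁻¹ := by simp [hc]
  have hu : cs.wordProd (alternatingWord i j (2 * m)) = c ^ m := by
    simp [prod_alternatingWord_eq_mul_pow, hc]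
  have huinv : (c ^ m)⁻¹ = c ^ m := by
    rw [inv_eq_iff_mul_eq_one, ← pow_add, ← two_mul, hpow]
  have hθj : θ (cs.simple j) = cs.simple i := by rw [← hj, hθ]
  have hθc : θ (c ^ m) = c ^ m := by
    rw [map_pow, hc, map_mul, hj, hθj, hcinv, inv_pow, huinv]
  have htc : t * c ^ m = c ^ m * t := by
    have h1 : t * cs.simple i = cs.simple j * t := by
      rw [hj] at he
      nth_rw 2 [← he]
      simp [mul_assoc]
    have h2 : t * cs.simple j = cs.simple i * t := by
      have := congrArg (fun x ↦ x⁻¹) h1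
      simp only [mul_inv_rev, cs.inv_simple, htinv] at this
      exact this.symm
    have h3 : SemiconjBy t c c⁻¹ := by
      rw [← hcinv]
      exact SemiconjBy.mul_right h1 h2
    have h4 := h3.pow_right m
    rw [inv_pow, huinv] at h4
    exact h4
  rw [hu] at hty
  have hy : y = t * c ^ m := by rw [hty, mul_assoc, ← pow_add, ← two_mul, hpow, mul_one]
  have hymem : y ∈ twistedInvolutions θ := by
    change θ y = y⁻¹
    rw [hy, map_mul, htfix, hθc, mul_inv_rev, huinv, htinv, htc]
  have hyo : Odd (cs.length y) := by
    rw [Nat.odd_iff] at hto ⊢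
    omega
  have := hmin y hymem hyo
  omega

end Twisted

theorem statement9 [Finite B] [Finite W] (cs : CoxeterSystem M W) (θ : W ≃* W)
    (hθ : Function.Involutive θ)
    (hθS : ∀ i : B, ∃ j : B, θ (cs.simple i) = cs.simple j)
    (hNOF : NOF cs θ)
    (w₀ : W) (hw₀ : ∀ w : W, cs.length w ≤ cs.length w₀)
    (hw₀I : w₀ ∈ twistedInvolutions θ)
    (h1 : 2 * twistRank cs θ w₀ = cs.length w₀ + 1) :
    ∃ (i : B) (l : List B), twistProd cs θ (i :: l) = w₀ ∧
      (i :: l).length = twistRank cs θ w₀ ∧ θ (cs.simple i) = cs.simple i := by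
  obtain ⟨i, hi⟩ := exists_map_simple_eq hθ hθS hNOF
    ⟨w₀, hw₀I, Nat.odd_iff.2 (by omega)⟩
  have hact : twistAct cs θ 1 i = cs.simple i := by
    rw [twistAct_of_eq (by simp [hi]), one_mul]
  have hasc : Ascends cs θ [i] (twistAct cs θ 1 i) :=
    Ascends.nil.snoc i (by simp [hact])
  obtain ⟨l, hl⟩ := hasc.exists_append hθ hθS hw₀
  exact ⟨i, l, hl.twistProd_eq, hl.length_eq_twistRank hθ hθS, hi⟩

end TwistedIdentitiesPaper
end

section
/- Let W be the affine Weyl group of type Ã₂, i.e., the Coxeter system with S = {s₁,s₂,s₃} and m(s₁,s₂) = m(s₁,s₃) = m(s₂,s₃) = 3, and let θ be the involutive automorphism with θ(s₁) = s₁, θ(s₂) = s₃, θ(s₃) = s₂. Set u = s₂s₃ and v = s₂s₁s₃s₂s₁s₃. Then e, u, v, s₃s₂, and s₁s₃s₂s₁ all lie in ι(θ); both e < u < v and e < s₃s₂ < s₁s₃s₂s₁ < v are maximal chains in the interval {x ∈ ι(θ) : e ≤ x ≤ v} of Br(ι(θ)); consequently Br(ι(θ)) is not graded. -/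
namespace TwistedIdentitiesPaper

open scoped Classical

variable {B : Type*} {W : Type*} [Group W] {M : CoxeterMatrix B}

/-- The Coxeter matrix of the affine Weyl group of type `Ã₂`. -/
def AffineA2 : CoxeterMatrix (Fin 3) where
  M := Matrix.of fun i j => if i = j then 1 else 3
  isSymm := by
    unfold Matrix.IsSymm
    decide
  diagonal := by simp
  off_diagonal := by
    intro i j h
    simp [Matrix.of_apply, h]

/-- The interval `[u,v]` of `Br(ι(θ))`. -/
def iotaInterval (cs : CoxeterSystem M W) (θ : W ≃* W) (u v : W) : Set W :=
  {x | x ∈ twistedIdentities θ ∧ bruhatLE cs u x ∧ bruhatLE cs x v}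

/-- `C` is a maximal chain of the interval `[u,v]` of `Br(ι(θ))`. -/
def IsMaximalChain (cs : CoxeterSystem M W) (θ : W ≃* W) (u v : W) (C : Set W) : Prop :=
  C ⊆ iotaInterval cs θ u v ∧ IsChain (bruhatLE cs) C ∧
    ∀ C' : Set W, C' ⊆ iotaInterval cs θ u v → IsChain (bruhatLE cs) C' → C ⊆ C' → C = C'

section AffineA2

variable {W : Type*} [Group W] (cs : CoxeterSystem AffineA2 W)

/-- The contragredient geometric action of the simple reflection `i` of type `Ã₂`. -/
def simpleAct (i : Fin 3) (c : ℤ × ℤ × ℤ) : ℤ × ℤ × ℤ :=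
  match i with
  | 0 => (-c.1, c.2.1 + c.1, c.2.2 + c.1)
  | 1 => (c.1 + c.2.1, -c.2.1, c.2.2 + c.2.1)
  | 2 => (c.1 + c.2.2, c.2.1 + c.2.2, -c.2.2)

lemma simpleAct_involutive (i : Fin 3) : Function.Involutive (simpleAct i) := by
  rintro ⟨a, b, c⟩
  fin_cases i <;> simp [simpleAct]

/-- `simpleAct i` as a permutation. -/
def simplePerm (i : Fin 3) : Equiv.Perm (ℤ × ℤ × ℤ) :=
  (simpleAct_involutive i).toPerm

lemma isLiftable_simplePerm : AffineA2.IsLiftable simplePerm := by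
  intro i j
  ext ⟨a, b, c⟩ : 1
  fin_cases i <;> fin_cases j <;>
    simp [AffineA2, simplePerm, simpleAct, pow_succ, Equiv.Perm.mul_apply] <;> grind

/-- The image of the generic point `(1, 1, 1)` under a word in the simple reflections. -/
def wordPoint (l : List (Fin 3)) : ℤ × ℤ × ℤ := l.foldr simpleAct (1, 1, 1)

lemma lift_wordProd_apply (l : List (Fin 3)) :
    cs.lift ⟨simplePerm, isLiftable_simplePerm⟩ (cs.wordProd l) (1, 1, 1) = wordPoint l := by
  induction l with
  | nil => simp [wordPoint]
  | cons i l ih =>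
    rw [cs.wordProd_cons, map_mul, cs.lift_apply_simple, Equiv.Perm.mul_apply, ih]
    rfl

lemma wordPoint_eq_of_wordProd_eq {l l' : List (Fin 3)} (h : cs.wordProd l = cs.wordProd l') :
    wordPoint l = wordPoint l' := by
  rw [← lift_wordProd_apply cs, ← lift_wordProd_apply cs, h]

/-- All words of length at most `n`. -/
def wordsUpTo : ℕ → List (List (Fin 3))
  | 0 => [[]]
  | n + 1 => [] :: (wordsUpTo n).flatMap fun l => [0 :: l, 1 :: l, 2 :: l]

lemma mem_wordsUpTo {l : List (Fin 3)} {n : ℕ} (h : l.length ≤ n) : l ∈ wordsUpTo n := by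
  induction n generalizing l with
  | zero => simpa [wordsUpTo] using h
  | succ n ih =>
    cases l with
    | nil => simp [wordsUpTo]
    | cons i l =>
      have hl := ih (l := l) (by simpa using h)
      simp only [wordsUpTo, List.mem_cons, List.mem_flatMap]
      refine Or.inr ⟨l, hl, ?_⟩
      fin_cases i <;> simp

/-- A word that is the only word of at most its length with its image of the generic point. -/
def IsRigid (w : List (Fin 3)) : Prop :=
  ∀ l ∈ wordsUpTo w.length, wordPoint l = wordPoint w → l = w

variable {cs} in
lemma IsRigid.eq {w l : List (Fin 3)} (hw : IsRigid w) (hl : cs.IsReduced l)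
    (h : cs.wordProd l = cs.wordProd w) : l = w :=
  hw l (mem_wordsUpTo (by rw [← hl.eq, h]; exact cs.length_wordProd_le w))
    (wordPoint_eq_of_wordProd_eq cs h)

lemma bruhatLE_wordProd_iff {w : List (Fin 3)} (hw : IsRigid w) (x : W) :
    bruhatLE cs x (cs.wordProd w) ↔ ∃ l, l.Sublist w ∧ cs.wordProd l = x := by
  constructor
  · intro h
    obtain ⟨l, hl, hlw⟩ := cs.exists_isReduced (cs.wordProd w)
    exact h w (hw.eq hl hlw.symm ▸ hl) rfl
  · intro h l hl hlw
    rwa [hw.eq hl hlw]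

lemma bruhatLE_of_sublist {w l : List (Fin 3)} (hw : IsRigid w) (h : l.Sublist w) :
    bruhatLE cs (cs.wordProd l) (cs.wordProd w) :=
  (bruhatLE_wordProd_iff cs hw _).2 ⟨l, h, rfl⟩

lemma not_bruhatLE {w u : List (Fin 3)} (hw : IsRigid w)
    (h : ∀ l ∈ w.sublists, wordPoint l ≠ wordPoint u) :
    ¬ bruhatLE cs (cs.wordProd u) (cs.wordProd w) := by
  rw [bruhatLE_wordProd_iff cs hw]
  rintro ⟨l, hl, hlu⟩
  exact h l (List.mem_sublists.2 hl) (wordPoint_eq_of_wordProd_eq cs hlu)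

lemma one_bruhatLE (x : W) : bruhatLE cs 1 x :=
  fun l _ _ => ⟨[], l.nil_sublist, cs.wordProd_nil⟩

lemma bruhatLE_refl (x : W) : bruhatLE cs x x :=
  fun l _ hl => ⟨l, List.Sublist.refl l, hl⟩

lemma isRigid_one_two : IsRigid [1, 2] := by unfold IsRigid; decide +kernel

lemma isRigid_two_one : IsRigid [2, 1] := by unfold IsRigid; decide +kernel

lemma isRigid_four : IsRigid [0, 2, 1, 0] := by unfold IsRigid; decide +kernel

lemma isRigid_six : IsRigid [1, 0, 2, 1, 0, 2] := by unfold IsRigid; decide +kernel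

lemma wordProd_one_two_one_two : cs.wordProd [1, 2, 1, 2] = cs.wordProd [2, 1] := by
  have h := cs.simple_mul_simple_pow 1 2
  have h3 : AffineA2 1 2 = 3 := by simp [AffineA2]
  rw [h3, pow_three] at h
  rw [← mul_inv_eq_one, ← h]
  simp [CoxeterSystem.wordProd, mul_assoc]

variable {cs} {θ : W ≃* W} (hθ1 : θ (cs.simple 0) = cs.simple 0)
    (hθ2 : θ (cs.simple 1) = cs.simple 2) (hθ3 : θ (cs.simple 2) = cs.simple 1)

include hθ1 hθ2 hθ3

lemma map_simple_eq_simple_neg (i : Fin 3) : θ (cs.simple i) = cs.simple (-i) := by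
  fin_cases i <;> simpa

lemma map_wordProd (l : List (Fin 3)) :
    θ (cs.wordProd l) = cs.wordProd (l.map fun i => -i) := by
  induction l with
  | nil => simp
  | cons i l ih =>
    rw [List.map_cons, cs.wordProd_cons, cs.wordProd_cons, map_mul, ih,
      map_simple_eq_simple_neg hθ1 hθ2 hθ3]

lemma wordProd_mem_twistedIdentities (l : List (Fin 3)) :
    cs.wordProd ((l.map fun i => -i).reverse ++ l) ∈ twistedIdentities θ := by
  refine ⟨cs.wordProd l, ?_⟩
  rw [cs.wordProd_append, cs.wordProd_reverse, map_inv, map_wordProd hθ1 hθ2 hθ3]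

lemma even_length_of_mem_twistedIdentities {l : List (Fin 3)}
    (h : cs.wordProd l ∈ twistedIdentities θ) : Even l.length := by
  obtain ⟨v, hv⟩ := h
  obtain ⟨w, rfl⟩ := cs.wordProd_surjective v
  have key : ∀ l : List (Fin 3),
      cs.lengthParity (cs.wordProd l) = Multiplicative.ofAdd (l.length : ZMod 2) := by
    intro l
    induction l with
    | nil => simp
    | cons i l ih =>
      rw [cs.wordProd_cons, map_mul, ih, cs.lengthParity_simple, ← ofAdd_add, List.length_cons,
        Nat.cast_succ, add_comm]
  have h := congrArg cs.lengthParity hv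
  rw [← cs.wordProd_reverse, map_wordProd hθ1 hθ2 hθ3, ← cs.wordProd_append, key, key] at h
  have h' : (l.length : ZMod 2) = ((w.length + w.length : ℕ) : ZMod 2) := by
    simpa using Multiplicative.ofAdd.injective h
  rw [← ZMod.natCast_eq_zero_iff_even, h', ZMod.natCast_eq_zero_iff_even]
  exact ⟨_, rfl⟩

lemma wordPoint_eq_of_mem_twistedIdentities {l : List (Fin 3)}
    (hθ : Function.Involutive θ) (h : cs.wordProd l ∈ twistedIdentities θ) :
    wordPoint ((l.map fun i => -i) ++ l) = (1, 1, 1) := by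
  refine wordPoint_eq_of_wordProd_eq cs (l' := []) ?_
  obtain ⟨v, hv⟩ := h
  rw [cs.wordProd_append, ← map_wordProd hθ1 hθ2 hθ3, hv]
  simp [hθ v]

lemma mem_of_mem_iotaInterval (hθ : Function.Involutive θ) {x : W}
    (hx : x ∈ iotaInterval cs θ 1 (cs.wordProd [1, 0, 2, 1, 0, 2])) :
    x = 1 ∨ x = cs.wordProd [1, 2] ∨ x = cs.wordProd [2, 1] ∨ x = cs.wordProd [0, 2, 1, 0] ∨
      x = cs.wordProd [1, 0, 2, 1, 0, 2] := by
  obtain ⟨hι, -, hle⟩ := hx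
  obtain ⟨l, hl, rfl⟩ := (bruhatLE_wordProd_iff cs isRigid_six x).1 hle
  have key : ∀ l ∈ ([1, 0, 2, 1, 0, 2] : List (Fin 3)).sublists, Even l.length →
      wordPoint ((l.map fun i => -i) ++ l) = (1, 1, 1) →
      l ∈ ([[], [0, 0], [1, 1], [2, 2], [1, 2], [1, 0, 0, 2], [2, 1], [1, 2, 1, 2],
        [0, 2, 1, 0], [1, 0, 2, 1, 0, 2]] : List (List (Fin 3))) := by
    decide +kernel
  have hmem := key l (List.mem_sublists.2 hl)
    (even_length_of_mem_twistedIdentities hθ1 hθ2 hθ3 hι)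
    (wordPoint_eq_of_mem_twistedIdentities hθ1 hθ2 hθ3 hθ hι)
  simp only [List.mem_cons, List.not_mem_nil, or_false] at hmem
  rcases hmem with rfl | rfl | rfl | rfl | rfl | rfl | rfl | rfl | rfl | rfl
  · simp
  · simp [CoxeterSystem.wordProd]
  · simp [CoxeterSystem.wordProd]
  · simp [CoxeterSystem.wordProd]
  · simp
  · simp [CoxeterSystem.wordProd]
  · simp
  · simp [wordProd_one_two_one_two]
  · simp
  · simp

end AffineA2

theorem statement12 {W : Type*} [Group W] (cs : CoxeterSystem AffineA2 W)
    (θ : W ≃* W) (hθ : Function.Involutive θ)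
    (hθ1 : θ (cs.simple 0) = cs.simple 0)
    (hθ2 : θ (cs.simple 1) = cs.simple 2)
    (hθ3 : θ (cs.simple 2) = cs.simple 1) :
    (1 : W) ∈ twistedIdentities θ ∧
    cs.wordProd [1, 2] ∈ twistedIdentities θ ∧
    cs.wordProd [1, 0, 2, 1, 0, 2] ∈ twistedIdentities θ ∧
    cs.wordProd [2, 1] ∈ twistedIdentities θ ∧
    cs.wordProd [0, 2, 1, 0] ∈ twistedIdentities θ ∧
    IsMaximalChain cs θ 1 (cs.wordProd [1, 0, 2, 1, 0, 2])
      {1, cs.wordProd [1, 2], cs.wordProd [1, 0, 2, 1, 0, 2]} ∧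
    IsMaximalChain cs θ 1 (cs.wordProd [1, 0, 2, 1, 0, 2])
      {1, cs.wordProd [2, 1], cs.wordProd [0, 2, 1, 0], cs.wordProd [1, 0, 2, 1, 0, 2]} ∧
    ({1, cs.wordProd [1, 2], cs.wordProd [1, 0, 2, 1, 0, 2]} : Set W).ncard = 3 ∧
    ({1, cs.wordProd [2, 1], cs.wordProd [0, 2, 1, 0],
        cs.wordProd [1, 0, 2, 1, 0, 2]} : Set W).ncard = 4 := by
  have hu : cs.wordProd [1, 2] ∈ twistedIdentities θ :=
    wordProd_mem_twistedIdentities hθ1 hθ2 hθ3 [2]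
  have hv : cs.wordProd [1, 0, 2, 1, 0, 2] ∈ twistedIdentities θ :=
    wordProd_mem_twistedIdentities hθ1 hθ2 hθ3 [1, 0, 2]
  have ha : cs.wordProd [2, 1] ∈ twistedIdentities θ :=
    wordProd_mem_twistedIdentities hθ1 hθ2 hθ3 [1]
  have hb : cs.wordProd [0, 2, 1, 0] ∈ twistedIdentities θ :=
    wordProd_mem_twistedIdentities hθ1 hθ2 hθ3 [1, 0]
  have h1 : (1 : W) ∈ twistedIdentities θ := ⟨1, by simp⟩
  have huv := bruhatLE_of_sublist cs (l := [1, 2]) isRigid_six (by decide)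
  have hav := bruhatLE_of_sublist cs (l := [2, 1]) isRigid_six (by decide)
  have hbv := bruhatLE_of_sublist cs (l := [0, 2, 1, 0]) isRigid_six (by decide)
  have hab := bruhatLE_of_sublist cs (l := [2, 1]) isRigid_four (by decide)
  have hua := not_bruhatLE cs (u := [1, 2]) isRigid_two_one (by decide +kernel)
  have hau := not_bruhatLE cs (u := [2, 1]) isRigid_one_two (by decide +kernel)
  have hub := not_bruhatLE cs (u := [1, 2]) isRigid_four (by decide +kernel)
  have hbu := not_bruhatLE cs (u := [0, 2, 1, 0]) isRigid_one_two (by decide +kernel)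
  have hne : ∀ {l l' : List (Fin 3)}, wordPoint l ≠ wordPoint l' →
      cs.wordProd l ≠ cs.wordProd l' := fun h h' => h (wordPoint_eq_of_wordProd_eq cs h')
  have hua' : cs.wordProd [1, 2] ≠ cs.wordProd [2, 1] := hne (by decide)
  have hub' : cs.wordProd [1, 2] ≠ cs.wordProd [0, 2, 1, 0] := hne (by decide)
  have huv' : cs.wordProd [1, 2] ≠ cs.wordProd [1, 0, 2, 1, 0, 2] := hne (by decide)
  have hab' : cs.wordProd [2, 1] ≠ cs.wordProd [0, 2, 1, 0] := hne (by decide)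
  have hav' : cs.wordProd [2, 1] ≠ cs.wordProd [1, 0, 2, 1, 0, 2] := hne (by decide)
  have hbv' : cs.wordProd [0, 2, 1, 0] ≠ cs.wordProd [1, 0, 2, 1, 0, 2] := hne (by decide)
  have h1u : 1 ≠ cs.wordProd [1, 2] := cs.wordProd_nil ▸ hne (by decide)
  have h1a : 1 ≠ cs.wordProd [2, 1] := cs.wordProd_nil ▸ hne (by decide)
  have h1b : 1 ≠ cs.wordProd [0, 2, 1, 0] := cs.wordProd_nil ▸ hne (by decide)
  have h1v : 1 ≠ cs.wordProd [1, 0, 2, 1, 0, 2] := cs.wordProd_nil ▸ hne (by decide)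
  have hclass := fun x => mem_of_mem_iotaInterval (x := x) hθ1 hθ2 hθ3 hθ
  have hone := one_bruhatLE cs
  have hrefl := bruhatLE_refl cs (cs.wordProd [1, 0, 2, 1, 0, 2])
  generalize cs.wordProd [1, 2] = u at *
  generalize cs.wordProd [2, 1] = a at *
  generalize cs.wordProd [0, 2, 1, 0] = b at *
  generalize cs.wordProd [1, 0, 2, 1, 0, 2] = v at *
  refine ⟨h1, hu, hv, ha, hb, ⟨?_, ?_, ?_⟩, ⟨?_, ?_, ?_⟩, ?_, ?_⟩
  · rintro x (rfl | rfl | rfl)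
    exacts [⟨h1, hone _, hone _⟩, ⟨hu, hone _, huv⟩, ⟨hv, hone _, hrefl⟩]
  · rintro x (rfl | rfl | rfl) y (rfl | rfl | rfl) hxy <;> simp_all
  · intro C hC hchain hsub
    refine hsub.antisymm fun x hx => ?_
    have hcmp : x ≠ u → bruhatLE cs x u ∨ bruhatLE cs u x :=
      hchain hx (hsub (by simp))
    rcases hclass x (hC hx) with rfl | rfl | rfl | rfl | rfl <;> simp_all
  · rintro x (rfl | rfl | rfl | rfl)
    exacts [⟨h1, hone _, hone _⟩, ⟨ha, hone _, hav⟩, ⟨hb, hone _, hbv⟩, ⟨hv, hone _, hrefl⟩]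
  · rintro x (rfl | rfl | rfl | rfl) y (rfl | rfl | rfl | rfl) hxy <;> simp_all
  · intro C hC hchain hsub
    refine hsub.antisymm fun x hx => ?_
    have hcmp : x ≠ a → bruhatLE cs x a ∨ bruhatLE cs a x :=
      hchain hx (hsub (by simp))
    rcases hclass x (hC hx) with rfl | rfl | rfl | rfl | rfl <;> simp_all
  · exact Set.ncard_eq_three.2 ⟨1, u, v, h1u, h1v, huv', rfl⟩
  · rw [Set.ncard_insert_of_notMem (by simp [*]),
      Set.ncard_eq_three.2 ⟨a, b, v, hab', hav', hbv', rfl⟩]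

end TwistedIdentitiesPaper
end
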